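/- Let f : ℝⁿ → ℝ be a real-valued function that is semi-algebraic, upper semicontinuous, and bounded on every compact subset of ℝⁿ. Then there exist m ∈ ℕ, polynomials P, Q : ℝⁿ × ℝᵐ → ℝ with Q(x,·) convex on ℝᵐ for every fixed x, and a nonempty compact convex semi-algebraic set 𝒴 ⊆ ℝᵐ, such that the pessimistic value function φ_p of the associated bilevel problem satisfies φ_p = f. -/

import Mathlib

open Set

noncomputable section

/-- The lower-level argmin set `Θ(x) = {y ∈ 𝒴 : ∀ y' ∈ 𝒴, Q(x,y) ≤ Q(x,y')}`. -/
def argminSet {n m : ℕ} (Q : (Fin n → ℝ) → (Fin m → ℝ) → ℝ) (Y : Set (Fin m → ℝ))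
    (x : Fin n → ℝ) : Set (Fin m → ℝ) :=
  {y | y ∈ Y ∧ ∀ y' ∈ Y, Q x y ≤ Q x y'}

/-- Optimistic value function `φ_o(x) = inf_{y ∈ Θ(x)} P(x,y)`,
with the convention `inf ∅ = +∞`. -/
def valOpt {n m : ℕ} (P Q : (Fin n → ℝ) → (Fin m → ℝ) → ℝ) (Y : Set (Fin m → ℝ))
    (x : Fin n → ℝ) : EReal :=
  ⨅ y ∈ argminSet Q Y x, ((P x y : ℝ) : EReal)

/-- Pessimistic value function `φ_p(x) = sup_{y ∈ Θ(x)} P(x,y)`,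
with the convention `sup ∅ = -∞`. -/
def valPess {n m : ℕ} (P Q : (Fin n → ℝ) → (Fin m → ℝ) → ℝ) (Y : Set (Fin m → ℝ))
    (x : Fin n → ℝ) : EReal :=
  ⨆ y ∈ argminSet Q Y x, ((P x y : ℝ) : EReal)

/-- `P (x, y)` is a real polynomial in the joint variables `(x, y)`. -/
def IsPolyMap {n m : ℕ} (P : (Fin n → ℝ) → (Fin m → ℝ) → ℝ) : Prop :=
  ∃ p : MvPolynomial (Fin n ⊕ Fin m) ℝ,
    ∀ x y, P x y = MvPolynomial.eval (Sum.elim x y) p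

/-- Basic semi-algebraic subset of `ℝ^ι`. -/
def IsBasicSemialgebraic {ι : Type} [Fintype ι] (S : Set (ι → ℝ)) : Prop :=
  ∃ (p : MvPolynomial ι ℝ) (k : ℕ) (q : Fin k → MvPolynomial ι ℝ),
    S = {x | MvPolynomial.eval x p = 0 ∧ ∀ j, 0 < MvPolynomial.eval x (q j)}

/-- Semi-algebraic set: a finite union of basic semi-algebraic sets. -/
def IsSemialgebraic {ι : Type} [Fintype ι] (S : Set (ι → ℝ)) : Prop :=
  ∃ (N : ℕ) (T : Fin N → Set (ι → ℝ)),
    (∀ i, IsBasicSemialgebraic (T i)) ∧ S = ⋃ i, T i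

/-- Semi-algebraic real-valued function: its graph (inside `ℝ^{ι} × ℝ ≅ ℝ^{ι ⊕ Unit}`)
is semi-algebraic. -/
def IsSemialgebraicFun {ι : Type} [Fintype ι] (f : (ι → ℝ) → ℝ) : Prop :=
  IsSemialgebraic {z : (ι ⊕ Unit) → ℝ | f (z ∘ Sum.inl) = z (Sum.inr ())}

/-- Extended-real-valued semi-algebraic function: the sets where it is finite, `+∞`, `-∞`
are semi-algebraic, and the graph of its restriction to its (finite) domain is
semi-algebraic. -/
def IsERealSemialgebraicFun {ι : Type} [Fintype ι] (h : (ι → ℝ) → EReal) : Prop :=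
  IsSemialgebraic {x | ∃ r : ℝ, h x = (r : EReal)} ∧
  IsSemialgebraic {x | h x = ⊤} ∧
  IsSemialgebraic {x | h x = ⊥} ∧
  IsSemialgebraic {z : (ι ⊕ Unit) → ℝ | h (z ∘ Sum.inl) = ((z (Sum.inr ()) : ℝ) : EReal)}

/-- A (possibly unbounded) box `[a₁,b₁] × ⋯ × [aₘ,bₘ]` in `ℝ^m`, with
endpoints in `ℝ ∪ {±∞}`. -/
def IsBox {m : ℕ} (Y : Set (Fin m → ℝ)) : Prop :=
  ∃ a b : Fin m → EReal,
    Y = {y | ∀ i, a i ≤ (y i : EReal) ∧ (y i : EReal) ≤ b i}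

/-- The bounded box `[a₁,b₁] × ⋯ × [aₘ,bₘ]` with real endpoints. -/
def boundedBox {m : ℕ} (a b : Fin m → ℝ) : Set (Fin m → ℝ) :=
  {y | ∀ i, y i ∈ Set.Icc (a i) (b i)}

/-- Piecewise polynomial function: there is a finite partition of `ℝ^n` into pairwise
disjoint semi-algebraic sets on each of which `f` coincides with a polynomial. -/
def IsPiecewisePolynomial {n : ℕ} (f : (Fin n → ℝ) → ℝ) : Prop :=
  ∃ (N : ℕ) (S : Fin N → Set (Fin n → ℝ)) (p : Fin N → MvPolynomial (Fin n) ℝ),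
    (∀ i, IsSemialgebraic (S i)) ∧
    (∀ i j, i ≠ j → Disjoint (S i) (S j)) ∧
    (⋃ i, S i) = Set.univ ∧
    (∀ i, ∀ x ∈ S i, f x = MvPolynomial.eval x (p i))

/-! ### Order isomorphisms of the real line -/

theorem exists_orderIso_map_eq_of_lt {a b s r : ℝ} (has : a < s) (hsr : s < r) (hrb : r < b) :
    ∃ ψ : ℝ ≃o ℝ, ψ s = r ∧ ∀ t, t ≤ a ∨ b ≤ t → ψ t = t := by
  set k : ℝ := (r - a) / (s - a) with hk
  set l : ℝ := (b - r) / (b - s) with hl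
  have hsa : 0 < s - a := by linarith
  have hbs : 0 < b - s := by linarith
  have hk1 : 1 < k := by rw [hk, one_lt_div hsa]; linarith
  have hl0 : 0 < l := div_pos (by linarith) hbs
  have hl1 : l < 1 := by rw [hl, div_lt_one hbs]; linarith
  have hks : k * (s - a) = r - a := by rw [hk]; field_simp
  have hls : l * (b - s) = b - r := by rw [hl]; field_simp
  let f : ℝ → ℝ := fun t => max t (min (a + k * (t - a)) (b - l * (b - t)))
  have hmono : StrictMono f := by
    intro x y hxy
    refine max_lt_max hxy (min_lt_min ?_ ?_)
    · nlinarith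
    · nlinarith
  have hfix : ∀ t, t ≤ a ∨ b ≤ t → f t = t := by
    intro t ht
    refine max_eq_left ?_
    rcases ht with ht | ht
    · exact (min_le_left _ _).trans (by nlinarith)
    · exact (min_le_right _ _).trans (by nlinarith)
  have hcont : Continuous f := by fun_prop
  have hsurj : Function.Surjective f := by
    refine hcont.surjective ?_ ?_
    · exact Filter.tendsto_atTop_mono (fun t => le_max_left _ _) Filter.tendsto_id
    · refine Filter.Tendsto.congr' ?_ Filter.tendsto_id
      filter_upwards [Filter.eventually_le_atBot a] with t ht
      exact (hfix t (Or.inl ht)).symm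
  refine ⟨hmono.orderIsoOfSurjective f hsurj, ?_, hfix⟩
  change max s (min (a + k * (s - a)) (b - l * (b - s))) = r
  rw [hks, hls]
  simp [hsr.le]

theorem exists_orderIso_map_eq {a b s r : ℝ} (has : a < s) (hsb : s < b) (har : a < r)
    (hrb : r < b) :
    ∃ ψ : ℝ ≃o ℝ, ψ s = r ∧ ∀ t, t ≤ a ∨ b ≤ t → ψ t = t := by
  rcases lt_trichotomy s r with h | rfl | h
  · exact exists_orderIso_map_eq_of_lt has h hrb
  · exact ⟨OrderIso.refl ℝ, rfl, fun _ _ => rfl⟩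
  · obtain ⟨ψ, h1, h2⟩ := exists_orderIso_map_eq_of_lt har h hsb
    refine ⟨ψ.symm, ?_, fun t ht => ?_⟩
    · rw [← h1, OrderIso.symm_apply_apply]
    · conv_lhs => rw [← h2 t ht]
      exact ψ.symm_apply_apply t

theorem Finset.exists_consecutive {Z : Finset ℝ} {lo hi t : ℝ} (hlo : lo ∈ Z) (hhi : hi ∈ Z)
    (h1 : lo < t) (h2 : t < hi) (ht : t ∉ Z) :
    ∃ a ∈ Z, ∃ b ∈ Z, a < t ∧ t < b ∧ ∀ z ∈ Z, z ≤ a ∨ b ≤ z := by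
  have hne1 : (Z.filter (· < t)).Nonempty := ⟨lo, by simp [hlo, h1]⟩
  have hne2 : (Z.filter (t < ·)).Nonempty := ⟨hi, by simp [hhi, h2]⟩
  have m1 := Finset.max'_mem _ hne1
  have m2 := Finset.min'_mem _ hne2
  rw [Finset.mem_filter] at m1 m2
  refine ⟨_, m1.1, _, m2.1, m1.2, m2.2, fun z hz => ?_⟩
  rcases lt_trichotomy z t with h | rfl | h
  · exact Or.inl (Finset.le_max' _ _ (by simp [hz, h]))
  · exact absurd hz ht
  · exact Or.inr (Finset.min'_le _ _ (by simp [hz, h]))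

theorem ContinuousOn.between_of_injOn {f : ℝ → ℝ} {a b t : ℝ} (hf : ContinuousOn f (Icc a b))
    (hi : InjOn f (Icc a b)) (hat : a < t) (htb : t < b) :
    (f a < f t ∧ f t < f b) ∨ (f b < f t ∧ f t < f a) := by
  have hab : a ≤ b := (hat.trans htb).le
  have ma : a ∈ Icc a b := ⟨le_rfl, hab⟩
  have mb : b ∈ Icc a b := ⟨hab, le_rfl⟩
  have mt : t ∈ Icc a b := ⟨hat.le, htb.le⟩
  rcases hf.strictMonoOn_of_injOn_Icc' hab hi with h | h
  · exact Or.inl ⟨h ma mt hat, h mt mb htb⟩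
  · exact Or.inr ⟨h mt mb htb, h ma mt hat⟩

theorem Continuous.exists_zero_of_neg_of_pos {f : ℝ → ℝ} (hf : Continuous f) {a b : ℝ}
    (hab : a < b) (ha : f a < 0) (hb : 0 < f b) : ∃ c, a < c ∧ c < b ∧ f c = 0 := by
  obtain ⟨c, hc, h⟩ := intermediate_value_Ioo hab.le hf.continuousOn (show (0:ℝ) ∈ Ioo _ _ from ⟨ha, hb⟩)
  exact ⟨c, hc.1, hc.2, h⟩

theorem Continuous.exists_zero_of_pos_of_neg {f : ℝ → ℝ} (hf : Continuous f) {a b : ℝ}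
    (hab : a < b) (ha : 0 < f a) (hb : f b < 0) : ∃ c, a < c ∧ c < b ∧ f c = 0 := by
  obtain ⟨c, hc, h⟩ := intermediate_value_Ioo' hab.le hf.continuousOn (show (0:ℝ) ∈ Ioo _ _ from ⟨hb, ha⟩)
  exact ⟨c, hc.1, hc.2, h⟩

theorem sign_eq_sign_cases {x y : ℝ} (h : SignType.sign x = SignType.sign y) :
    (x < 0 ∧ y < 0) ∨ (x = 0 ∧ y = 0) ∨ (0 < x ∧ 0 < y) := by
  rcases lt_trichotomy x 0 with hx | hx | hx
  · rw [sign_neg hx, eq_comm, sign_eq_neg_one_iff] at h; exact Or.inl ⟨hx, h⟩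
  · rw [hx, sign_zero, eq_comm, sign_eq_zero_iff] at h; exact Or.inr (Or.inl ⟨hx, h⟩)
  · rw [sign_pos hx, eq_comm, sign_eq_one_iff] at h; exact Or.inr (Or.inr ⟨hx, h⟩)

theorem injOn_Icc_of_rolle {f : ℝ → ℝ} {Z : Finset ℝ} {a b : ℝ}
    (hf : ∀ x y, x < y → f x = f y → ∃ z ∈ Z, x < z ∧ z < y)
    (hZ : ∀ z ∈ Z, z ≤ a ∨ b ≤ z) : InjOn f (Icc a b) := by
  intro x hx y hy hxy
  rcases lt_trichotomy x y with h | h | h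
  · obtain ⟨z, hz, h1, h2⟩ := hf x y h hxy
    rcases hZ z hz with h3 | h3
    · linarith [hx.1]
    · linarith [hy.2]
  · exact h
  · obtain ⟨z, hz, h1, h2⟩ := hf y x h hxy.symm
    rcases hZ z hz with h3 | h3
    · linarith [hy.1]
    · linarith [hx.2]

/-- Two functions which are injective between consecutive points of `Z`, have the same signs on
`Z` and the same signs near `±∞`, have the same signs up to an order isomorphism fixing `Z`. -/
theorem exists_orderIso_sign_eq {p g : ℝ → ℝ} (hp : Continuous p) (hg : Continuous g)
    (Z R : Finset ℝ) (hZ : ∀ z ∈ Z, SignType.sign (p z) = SignType.sign (g z))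
    (hpZ : ∀ x y, x < y → p x = p y → ∃ z ∈ Z, x < z ∧ z < y)
    (hgZ : ∀ x y, x < y → g x = g y → ∃ z ∈ Z, x < z ∧ z < y)
    (hR : ∀ t, t ∈ R ↔ p t = 0) {lo hi : ℝ} (hlo : lo ∈ Z) (hhi : hi ∈ Z)
    (hlo' : ∀ s t, s ≤ lo → t ≤ lo → p s ≠ 0 ∧ SignType.sign (p s) = SignType.sign (g t))
    (hhi' : ∀ s t, hi ≤ s → hi ≤ t → p s ≠ 0 ∧ SignType.sign (p s) = SignType.sign (g t)) :
    ∃ ψ : ℝ ≃o ℝ, (∀ z ∈ Z, ψ z = z) ∧ ∀ t, SignType.sign (p t) = SignType.sign (g (ψ t)) := by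
  have roots : ∀ B : Finset ℝ, B ⊆ R → ∃ ψ : ℝ ≃o ℝ, (∀ z ∈ Z, ψ z = z) ∧
      ∀ r ∈ B, g (ψ r) = 0 := by
    intro B
    induction B using Finset.induction_on with
    | empty => exact fun _ => ⟨OrderIso.refl ℝ, fun _ _ => rfl, by simp⟩
    | insert r B hrB ih =>
      intro hB
      obtain ⟨ψ, h1, h2⟩ := ih ((Finset.subset_insert _ _).trans hB)
      have hr0 : p r = 0 := (hR r).1 (hB (Finset.mem_insert_self _ _))
      by_cases hrZ : r ∈ Z
      · refine ⟨ψ, h1, fun t ht => ?_⟩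
        rcases Finset.mem_insert.1 ht with rfl | ht
        · rw [h1 t hrZ]
          have := hZ t hrZ
          rwa [hr0, sign_zero, eq_comm, sign_eq_zero_iff] at this
        · exact h2 t ht
      have hlor : lo < r := by
        by_contra! h
        exact (hlo' r r h h).1 hr0
      have hrhi : r < hi := by
        by_contra! h
        exact (hhi' r r h h).1 hr0
      obtain ⟨a, haZ, b, hbZ, har, hrb, hab⟩ := Finset.exists_consecutive hlo hhi hlor hrhi hrZ
      have hinj := injOn_Icc_of_rolle hpZ hab
      obtain ⟨r', har', hrb', hr'⟩ : ∃ c, a < c ∧ c < b ∧ g c = 0 := by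
        have hsa := sign_eq_sign_cases (hZ a haZ)
        have hsb := sign_eq_sign_cases (hZ b hbZ)
        rcases hp.continuousOn.between_of_injOn hinj har hrb with ⟨h3, h4⟩ | ⟨h3, h4⟩
        · refine hg.exists_zero_of_neg_of_pos (har.trans hrb) ?_ ?_
          · rcases hsa with h | h | h <;> linarith
          · rcases hsb with h | h | h <;> linarith
        · refine hg.exists_zero_of_pos_of_neg (har.trans hrb) ?_ ?_
          · rcases hsa with h | h | h <;> linarith
          · rcases hsb with h | h | h <;> linarith
      have hψa : ψ a = a := h1 a haZ
      have hψb : ψ b = b := h1 b hbZ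
      obtain ⟨θ, hθr, hθ⟩ := exists_orderIso_map_eq (a := a) (b := b) (s := ψ r) (r := r')
        (by rw [← hψa]; exact ψ.strictMono har) (by rw [← hψb]; exact ψ.strictMono hrb) har' hrb'
      refine ⟨ψ.trans θ, fun z hz => ?_, fun t ht => ?_⟩
      · rw [OrderIso.trans_apply, h1 z hz, hθ z (hab z hz)]
      · rw [OrderIso.trans_apply]
        rcases Finset.mem_insert.1 ht with rfl | htB
        · rw [hθr, hr']
        · have ht0 : p t = 0 := (hR t).1 (hB ht)
          rw [hθ, h2 t htB]
          by_contra! hcon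
          have ht1 : a < t := by
            by_contra! h
            have := ψ.monotone h
            linarith
          have ht2 : t < b := by
            by_contra! h
            have := ψ.monotone h
            linarith
          have : t = r := hinj ⟨ht1.le, ht2.le⟩ ⟨har.le, hrb.le⟩ (ht0.trans hr0.symm)
          exact hrB (this ▸ htB)
  obtain ⟨ψ, h1, h2⟩ := roots R subset_rfl
  refine ⟨ψ, h1, fun t => ?_⟩
  by_cases htZ : t ∈ Z
  · rw [h1 t htZ, hZ t htZ]
  by_cases htR : t ∈ R
  · rw [h2 t htR, (hR t).1 htR]
  rcases le_total t lo with hlt | hlt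
  · refine (hlo' t _ hlt ?_).2
    rw [← h1 lo hlo]
    exact ψ.monotone hlt
  rcases le_total hi t with hht | hht
  · refine (hhi' t _ hht ?_).2
    rw [← h1 hi hhi]
    exact ψ.monotone hht
  have hlt' : lo < t := lt_of_le_of_ne hlt fun h => htZ (h ▸ hlo)
  have hht' : t < hi := lt_of_le_of_ne hht fun h => htZ (h ▸ hhi)
  obtain ⟨a, haW, b, hbW, hat, htb, hab⟩ := Finset.exists_consecutive (Z := Z ∪ R)
    (Finset.mem_union_left _ hlo) (Finset.mem_union_left _ hhi) hlt' hht' (by simp [htZ, htR])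
  have hW : ∀ w ∈ Z ∪ R, SignType.sign (p w) = SignType.sign (g (ψ w)) := by
    intro w hw
    rcases Finset.mem_union.1 hw with hw | hw
    · rw [h1 w hw, hZ w hw]
    · rw [h2 w hw, (hR w).1 hw]
  have hginj : InjOn g (Icc (ψ a) (ψ b)) := by
    refine injOn_Icc_of_rolle hgZ fun z hz => ?_
    rw [← h1 z hz]
    exact (hab z (Finset.mem_union_left _ hz)).imp (fun h => ψ.monotone h) fun h => ψ.monotone h
  have hgb := hg.continuousOn.between_of_injOn hginj (ψ.strictMono hat) (ψ.strictMono htb)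
  have hsa := sign_eq_sign_cases (hW a haW)
  have hsb := sign_eq_sign_cases (hW b hbW)
  have hnz : ∀ c, a < c → c < b → p c ≠ 0 := by
    intro c hac hcb hc
    rcases hab c (Finset.mem_union_right _ ((hR c).2 hc)) with h | h <;> linarith
  rcases lt_or_gt_of_ne (hnz t hat htb) with hneg | hpos
  · have ha : ¬ 0 < p a := fun h => by
      obtain ⟨c, hc1, hc2, hc⟩ := hp.exists_zero_of_pos_of_neg hat h hneg
      exact hnz c hc1 (hc2.trans htb) hc
    have hb : ¬ 0 < p b := fun h => by
      obtain ⟨c, hc1, hc2, hc⟩ := hp.exists_zero_of_neg_of_pos htb hneg h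
      exact hnz c (hat.trans hc1) hc2 hc
    have ha' : g (ψ a) ≤ 0 := by rcases hsa with h | h | h <;> linarith
    have hb' : g (ψ b) ≤ 0 := by rcases hsb with h | h | h <;> linarith
    rw [sign_neg hneg, sign_neg]
    rcases hgb with h | h <;> linarith
  · have ha : ¬ p a < 0 := fun h => by
      obtain ⟨c, hc1, hc2, hc⟩ := hp.exists_zero_of_neg_of_pos hat h hpos
      exact hnz c hc1 (hc2.trans htb) hc
    have hb : ¬ p b < 0 := fun h => by
      obtain ⟨c, hc1, hc2, hc⟩ := hp.exists_zero_of_pos_of_neg htb hpos h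
      exact hnz c (hat.trans hc1) hc2 hc
    have ha' : 0 ≤ g (ψ a) := by rcases hsa with h | h | h <;> linarith
    have hb' : 0 ≤ g (ψ b) := by rcases hsb with h | h | h <;> linarith
    rw [sign_pos hpos, sign_pos]
    rcases hgb with h | h <;> linarith

/-! ### Signs of polynomials depending on parameters -/

theorem Polynomial.eventually_sign_eq {P : Polynomial ℝ} {l : Filter ℝ} {u : ℝ → ℝ} {s : SignType}
    (h : Asymptotics.IsEquivalent l (fun t => P.eval t) u)
    (hu : ∀ᶠ t in l, SignType.sign (u t) = s) : ∀ᶠ t in l, SignType.sign (P.eval t) = s := by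
  obtain ⟨c, hc, hcu⟩ := h.exists_eq_mul
  have hc0 : ∀ᶠ t in l, 0 < c t := hc.eventually (lt_mem_nhds one_pos)
  filter_upwards [hu, hcu, hc0] with t h1 h2 h3
  rw [h2, Pi.mul_apply, sign_mul, sign_pos h3, one_mul, h1]

theorem Polynomial.eventually_atTop_sign_eq (P : Polynomial ℝ) :
    ∀ᶠ t in Filter.atTop, SignType.sign (P.eval t) = SignType.sign P.leadingCoeff := by
  refine Polynomial.eventually_sign_eq P.isEquivalent_atTop_lead ?_
  filter_upwards [Filter.eventually_gt_atTop 0] with t ht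
  rw [sign_mul, sign_pos (pow_pos ht _), mul_one]

theorem Polynomial.eventually_atBot_sign_eq (P : Polynomial ℝ) :
    ∀ᶠ t in Filter.atBot, SignType.sign (P.eval t) =
      SignType.sign P.leadingCoeff * (-1) ^ P.natDegree := by
  refine Polynomial.eventually_sign_eq P.isEquivalent_atBot_lead ?_
  filter_upwards [Filter.eventually_lt_atBot 0] with t ht
  rw [sign_mul, sign_pow, sign_neg ht]

theorem sign_eq_of_forall_ne_zero {f : ℝ → ℝ} (hf : Continuous f) {a b : ℝ}
    (h : ∀ z ∈ uIcc a b, f z ≠ 0) : SignType.sign (f a) = SignType.sign (f b) := by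
  have no0 : (0 : ℝ) ∉ uIcc (f a) (f b) := by
    intro h0
    obtain ⟨z, hz, hz0⟩ := intermediate_value_uIcc hf.continuousOn h0
    exact h z hz hz0
  rcases lt_or_gt_of_ne (h a left_mem_uIcc) with h1 | h1 <;>
    rcases lt_or_gt_of_ne (h b right_mem_uIcc) with h2 | h2
  · rw [sign_neg h1, sign_neg h2]
  · exact absurd (mem_uIcc.2 (Or.inl ⟨h1.le, h2.le⟩)) no0
  · exact absurd (mem_uIcc.2 (Or.inr ⟨h2.le, h1.le⟩)) no0
  · rw [sign_pos h1, sign_pos h2]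

theorem sign_eval_eq_of_fix_roots (P : Polynomial ℝ) (ψ : ℝ ≃o ℝ)
    (h : P ≠ 0 → ∀ z, P.eval z = 0 → ψ z = z) (t : ℝ) :
    SignType.sign (P.eval t) = SignType.sign (P.eval (ψ t)) := by
  by_cases hP : P = 0
  · simp [hP]
  replace h := h hP
  by_cases ht : P.eval t = 0
  · rw [h t ht]
  have hnz : ∀ z ∈ uIcc t (ψ t), P.eval z ≠ 0 := by
    intro z hz hz0
    have hψ := h z hz0
    have : z = t := by
      rcases le_total t (ψ t) with h1 | h1
      · rw [uIcc_of_le h1] at hz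
        refine le_antisymm ?_ hz.1
        rw [← ψ.le_iff_le, hψ]
        exact hz.2
      · rw [uIcc_of_ge h1] at hz
        refine le_antisymm hz.2 ?_
        rw [← ψ.le_iff_le, hψ]
        exact hz.1
    exact ht (this ▸ hz0)
  exact sign_eq_of_forall_ne_zero P.continuous hnz

section Param

variable {A : Type*} [CommRing A]

theorem exists_pseudo_division (q : Polynomial A) (hq : 0 < q.natDegree) (p : Polynomial A) :
    ∃ (k : ℕ) (s r : Polynomial A),
      Polynomial.C q.leadingCoeff ^ k * p = q * s + r ∧ r.natDegree < q.natDegree := by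
  induction hd : p.natDegree using Nat.strong_induction_on generalizing p with
  | _ d ih =>
    by_cases hlt : p.natDegree < q.natDegree
    · exact ⟨0, 0, p, by simp, hlt⟩
    push Not at hlt
    set p₁ := Polynomial.C q.leadingCoeff * p -
      Polynomial.C p.leadingCoeff * Polynomial.X ^ (p.natDegree - q.natDegree) * q with hp₁
    have hdeg : p₁.natDegree ≤ p.natDegree := by
      refine (Polynomial.natDegree_sub_le _ _).trans (max_le ?_ ?_)
      · exact Polynomial.natDegree_C_mul_le _ _
      · refine Polynomial.natDegree_mul_le.trans ?_
        have := Polynomial.natDegree_C_mul_X_pow_le p.leadingCoeff (p.natDegree - q.natDegree)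
        omega
    have hcoeff : p₁.coeff p.natDegree = 0 := by
      have h1 : (Polynomial.C p.leadingCoeff * Polynomial.X ^ (p.natDegree - q.natDegree) *
          q).coeff p.natDegree = p.leadingCoeff * q.leadingCoeff := by
        conv_lhs => rw [show p.natDegree = q.natDegree + (p.natDegree - q.natDegree) by omega]
        rw [mul_assoc, Polynomial.coeff_C_mul, mul_comm (Polynomial.X ^ _)]
        simp only [add_tsub_cancel_left, Polynomial.coeff_mul_X_pow,
          Polynomial.coeff_natDegree]
      rw [hp₁, Polynomial.coeff_sub, h1, Polynomial.coeff_C_mul, Polynomial.coeff_natDegree]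
      ring
    have hlt₁ : p₁.natDegree < d := by
      have := Polynomial.natDegree_le_pred hdeg hcoeff
      omega
    obtain ⟨k, s, r, h1, h2⟩ := ih _ hlt₁ p₁ rfl
    refine ⟨k + 1, s + Polynomial.C q.leadingCoeff ^ k *
      (Polynomial.C p.leadingCoeff * Polynomial.X ^ (p.natDegree - q.natDegree)), r, ?_, h2⟩
    rw [hp₁] at h1
    linear_combination h1

theorem eval₂_eraseLead_of_map_leadingCoeff_eq_zero {x : A →+* ℝ} {q : Polynomial A}
    (h : x q.leadingCoeff = 0) (t : ℝ) : q.eraseLead.eval₂ x t = q.eval₂ x t := by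
  conv_rhs => rw [← Polynomial.eraseLead_add_C_mul_X_pow q, Polynomial.eval₂_add,
    Polynomial.eval₂_mul, Polynomial.eval₂_C, h, zero_mul, add_zero]

/-- At the roots of `q`, the sign of `p` is determined by finitely many polynomials of degree
smaller than the degree of `q`. -/
theorem exists_sign_determined_at_roots (p q : Polynomial A) :
    ∃ (R : Finset (Polynomial A)) (L : Finset A), (∀ r ∈ R, r.natDegree < q.natDegree) ∧
      ∀ (x x' : A →+* ℝ) (t t' : ℝ), (∀ a ∈ L, SignType.sign (x a) = SignType.sign (x' a)) →
        q.map x ≠ 0 → q.eval₂ x t = 0 → q.eval₂ x' t' = 0 →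
        (∀ r ∈ R, SignType.sign (r.eval₂ x t) = SignType.sign (r.eval₂ x' t')) →
        SignType.sign (p.eval₂ x t) = SignType.sign (p.eval₂ x' t') := by
  classical
  induction hd : q.natDegree using Nat.strong_induction_on generalizing q with
  | _ d ih =>
    rcases Nat.eq_zero_or_pos d with h0 | hpos
    · refine ⟨∅, ∅, by simp, fun x x' t t' _ hq ht _ _ => (hq ?_).elim⟩
      rw [Polynomial.eq_C_of_natDegree_eq_zero (hd.trans h0)] at ht ⊢
      rw [Polynomial.eval₂_C] at ht
      rw [Polynomial.map_C, ht, Polynomial.C_0]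
    have hle := q.eraseLead_natDegree_le
    obtain ⟨R, L, hR, hRL⟩ := ih q.eraseLead.natDegree (by omega) q.eraseLead rfl
    obtain ⟨k, s, r, h1, h2⟩ := exists_pseudo_division q (by omega) p
    refine ⟨insert (Polynomial.C q.leadingCoeff ^ k * r) R, insert q.leadingCoeff L, ?_, ?_⟩
    · intro r' hr'
      rcases Finset.mem_insert.1 hr' with rfl | hr'
      · rw [← Polynomial.C_pow]
        exact (Polynomial.natDegree_C_mul_le _ _).trans_lt (hd ▸ h2)
      · exact (hR r' hr').trans_le (by omega)
    · intro x x' t t' hL hq ht ht' hsR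
      have hlc := sign_eq_sign_cases (hL _ (Finset.mem_insert_self _ _))
      by_cases hx : x q.leadingCoeff = 0
      · have hx' : x' q.leadingCoeff = 0 := by rcases hlc with h | h | h <;> linarith
        refine hRL x x' t t' (fun a ha => hL a (Finset.mem_insert_of_mem ha)) ?_ ?_ ?_
          fun r hr => hsR r (Finset.mem_insert_of_mem hr)
        · intro h
          refine hq (Polynomial.funext fun u => ?_)
          rw [Polynomial.eval_map, ← eval₂_eraseLead_of_map_leadingCoeff_eq_zero hx,
            ← Polynomial.eval_map, h]
        · rw [eval₂_eraseLead_of_map_leadingCoeff_eq_zero hx, ht]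
        · rw [eval₂_eraseLead_of_map_leadingCoeff_eq_zero hx', ht']
      · have hx' : x' q.leadingCoeff ≠ 0 := by
          rcases hlc with h | h | h
          · exact h.2.ne
          · exact absurd h.1 hx
          · exact h.2.ne'
        have key : ∀ (y : A →+* ℝ) (u : ℝ), y q.leadingCoeff ≠ 0 → q.eval₂ y u = 0 →
            SignType.sign ((Polynomial.C q.leadingCoeff ^ k * r).eval₂ y u) =
              SignType.sign (p.eval₂ y u) := by
          intro y u hy hu
          have h3 := congrArg (Polynomial.eval₂ y u) h1
          simp only [Polynomial.eval₂_mul, Polynomial.eval₂_add, Polynomial.eval₂_pow,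
            Polynomial.eval₂_C, hu, zero_mul, zero_add] at h3 ⊢
          rw [← h3, ← mul_assoc, sign_mul, ← pow_add, sign_pos, one_mul]
          exact Even.pow_pos ⟨k, rfl⟩ hy
        rw [← key x t hx ht, ← key x' t' hx' ht']
        exact hsR _ (Finset.mem_insert_self _ _)

theorem exists_orderIso_sign_eval₂_eq {x x' : A →+* ℝ} {F : Finset (Polynomial A)}
    {p : Polynomial A} {φ : ℝ ≃o ℝ}
    (hF : ∀ q ∈ F, ∀ t, SignType.sign (q.eval₂ x t) = SignType.sign (q.eval₂ x' (φ t)))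
    (hder : Polynomial.derivative p ∈ F) (hdeg : 0 < p.natDegree)
    (hlc : SignType.sign (x p.leadingCoeff) = SignType.sign (x' p.leadingCoeff))
    (hx : x p.leadingCoeff ≠ 0)
    (hroot : ∀ q ∈ F, q.map x ≠ 0 → ∀ t, q.eval₂ x t = 0 →
      SignType.sign (p.eval₂ x t) = SignType.sign (p.eval₂ x' (φ t))) :
    ∃ ψ : ℝ ≃o ℝ, ∀ q ∈ insert p (F : Set (Polynomial A)), ∀ t,
      SignType.sign (q.eval₂ x t) = SignType.sign (q.eval₂ x' (ψ t)) := by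
  classical
  have hx' : x' p.leadingCoeff ≠ 0 := by
    rcases sign_eq_sign_cases hlc with h | h | h
    · exact h.2.ne
    · exact absurd h.1 hx
    · exact h.2.ne'
  simp only [← Polynomial.eval_map] at hF hroot ⊢
  set P := p.map x with hP
  set G := p.map x' with hG
  have hPd : P.natDegree = p.natDegree := Polynomial.natDegree_map_of_leadingCoeff_ne_zero x hx
  have hGd : G.natDegree = p.natDegree := Polynomial.natDegree_map_of_leadingCoeff_ne_zero x' hx'
  have hPl : P.leadingCoeff = x p.leadingCoeff :=
    Polynomial.leadingCoeff_map_of_leadingCoeff_ne_zero x hx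
  have hGl : G.leadingCoeff = x' p.leadingCoeff :=
    Polynomial.leadingCoeff_map_of_leadingCoeff_ne_zero x' hx'
  have hP0 : P ≠ 0 := fun h => by simp [h] at hPd; omega
  have hdP : (Polynomial.derivative p).map x ≠ 0 := by
    rw [← Polynomial.derivative_map]
    intro h
    have : P.natDegree = 0 := Polynomial.derivative_eq_zero.1 h
    omega
  have hsl : SignType.sign P.leadingCoeff ≠ 0 := by
    rw [hPl]; exact fun h => hx (sign_eq_zero_iff.1 h)
  -- the signs near `±∞`
  obtain ⟨lo₁, hlo₁⟩ := Filter.eventually_atBot.1 P.eventually_atBot_sign_eq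
  obtain ⟨lo₂, hlo₂⟩ := Filter.eventually_atBot.1 G.eventually_atBot_sign_eq
  obtain ⟨hi₁, hhi₁⟩ := Filter.eventually_atTop.1 P.eventually_atTop_sign_eq
  obtain ⟨hi₂, hhi₂⟩ := Filter.eventually_atTop.1 G.eventually_atTop_sign_eq
  set lo := min lo₁ (φ.symm lo₂)
  set hi := max hi₁ (φ.symm hi₂)
  have hlo : ∀ s t, s ≤ lo → t ≤ lo → P.eval s ≠ 0 ∧
      SignType.sign (P.eval s) = SignType.sign (G.eval (φ t)) := by
    intro s t hs ht
    have e1 := hlo₁ s (hs.trans (min_le_left _ _))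
    have e2 := hlo₂ (φ t) (by rw [← OrderIso.le_symm_apply]; exact ht.trans (min_le_right _ _))
    refine ⟨fun h0 => ?_, ?_⟩
    · rw [h0, sign_zero] at e1
      exact mul_ne_zero hsl (pow_ne_zero _ (by decide)) e1.symm
    · rw [e1, e2, hPl, hGl, hPd, hGd, hlc]
  have hhi : ∀ s t, hi ≤ s → hi ≤ t → P.eval s ≠ 0 ∧
      SignType.sign (P.eval s) = SignType.sign (G.eval (φ t)) := by
    intro s t hs ht
    have e1 := hhi₁ s ((le_max_left _ _).trans hs)
    have e2 := hhi₂ (φ t) (by rw [← OrderIso.symm_apply_le]; exact (le_max_right _ _).trans ht)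
    refine ⟨fun h0 => ?_, ?_⟩
    · rw [h0, sign_zero] at e1
      exact hsl e1.symm
    · rw [e1, e2, hPl, hGl, hlc]
  set Z : Finset ℝ := insert lo (insert hi (F.biUnion fun q => (q.map x).roots.toFinset)) with hZ
  have mem_Z : ∀ q ∈ F, q.map x ≠ 0 → ∀ z, (q.map x).eval z = 0 → z ∈ Z := by
    intro q hq hq0 z hz
    refine Finset.mem_insert_of_mem (Finset.mem_insert_of_mem (Finset.mem_biUnion.2 ⟨q, hq, ?_⟩))
    rw [Multiset.mem_toFinset, Polynomial.mem_roots hq0]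
    exact hz
  obtain ⟨ψ, h1, h2⟩ := exists_orderIso_sign_eq (p := fun t => P.eval t)
    (g := fun t => G.eval (φ t)) P.continuous (G.continuous.comp φ.continuous) Z P.roots.toFinset
    (by
      intro z hz
      rw [hZ, Finset.mem_insert, Finset.mem_insert, Finset.mem_biUnion] at hz
      rcases hz with rfl | rfl | ⟨q, hq, hz⟩
      · exact (hlo lo lo le_rfl le_rfl).2
      · exact (hhi hi hi le_rfl le_rfl).2
      · rw [Multiset.mem_toFinset] at hz
        exact hroot q hq (Polynomial.ne_zero_of_mem_roots hz) z (Polynomial.isRoot_of_mem_roots hz))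
    (by
      intro a b hab hPab
      obtain ⟨c, hc, hc0⟩ := exists_hasDerivAt_eq_zero hab P.continuous.continuousOn hPab
        fun y _ => P.hasDerivAt y
      rw [hP, Polynomial.derivative_map] at hc0
      exact ⟨c, mem_Z _ hder hdP c hc0, hc.1, hc.2⟩)
    (by
      intro a b hab hGab
      obtain ⟨c, hc, hc0⟩ := exists_hasDerivAt_eq_zero (φ.strictMono hab)
        G.continuous.continuousOn hGab fun y _ => G.hasDerivAt y
      rw [hG, Polynomial.derivative_map] at hc0
      refine ⟨φ.symm c, mem_Z _ hder hdP _ ?_, ?_, ?_⟩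
      · have := hF _ hder (φ.symm c)
        rwa [OrderIso.apply_symm_apply, hc0, sign_zero, sign_eq_zero_iff] at this
      · rw [OrderIso.lt_symm_apply]; exact hc.1
      · rw [OrderIso.symm_apply_lt]; exact hc.2)
    (fun t => by rw [Multiset.mem_toFinset, Polynomial.mem_roots hP0]; rfl)
    (Finset.mem_insert_self _ _) (Finset.mem_insert_of_mem (Finset.mem_insert_self _ _)) hlo hhi
  refine ⟨ψ.trans φ, fun q hq t => ?_⟩
  rcases hq with rfl | hq
  · exact h2 t
  · rw [OrderIso.trans_apply, ← hF q hq]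
    exact sign_eval_eq_of_fix_roots _ ψ (fun h0 z hz => h1 z (mem_Z q hq h0 z hz)) t

/-- The signs of the finitely many elements of some `L` at a parameter `x` determine the
configuration of signs on the line of the polynomials in `F`, up to reparametrization. -/
def SignsDetermined (F : Finset (Polynomial A)) : Prop :=
  ∃ L : Finset A, ∀ x x' : A →+* ℝ, (∀ a ∈ L, SignType.sign (x a) = SignType.sign (x' a)) →
    ∃ φ : ℝ ≃o ℝ, ∀ q ∈ F, ∀ t, SignType.sign (q.eval₂ x t) = SignType.sign (q.eval₂ x' (φ t))

theorem SignsDetermined.insert [DecidableEq (Polynomial A)] {F : Finset (Polynomial A)}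
    {p : Polynomial A} (hF : ∀ q ∈ F, q.natDegree ≤ p.natDegree)
    (H : ∀ F' : Finset (Polynomial A), (∀ q ∈ F', q.natDegree < p.natDegree) →
      SignsDetermined (F ∪ F')) : SignsDetermined (insert p F) := by
  classical
  rcases Nat.eq_zero_or_pos p.natDegree with h0 | hpos
  · obtain ⟨L, hL⟩ := H ∅ (by simp)
    refine ⟨Insert.insert (p.coeff 0) L, fun x x' hxx => ?_⟩
    obtain ⟨φ, hφ⟩ := hL x x' fun a ha => hxx a (Finset.mem_insert_of_mem ha)
    refine ⟨φ, fun q hq t => ?_⟩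
    rcases Finset.mem_insert.1 hq with rfl | hq
    · rw [Polynomial.eq_C_of_natDegree_eq_zero h0, Polynomial.eval₂_C, Polynomial.eval₂_C]
      exact hxx _ (Finset.mem_insert_self _ _)
    · exact hφ q (Finset.mem_union_left _ hq) t
  choose R C hR hRC using fun q : Polynomial A => exists_sign_determined_at_roots p q
  set p' := Polynomial.derivative p
  have hp' : p'.natDegree < p.natDegree := Polynomial.natDegree_derivative_lt hpos.ne'
  set F₁ := Insert.insert p' F with hF₁
  have hF₁d : ∀ q ∈ F₁, q.natDegree ≤ p.natDegree := by
    intro q hq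
    rcases Finset.mem_insert.1 hq with rfl | hq
    · exact hp'.le
    · exact hF q hq
  have hel : p.eraseLead.natDegree < p.natDegree := by
    have := p.eraseLead_natDegree_le
    omega
  obtain ⟨L₀, hL₀⟩ := H {p.eraseLead} (by simpa using hel)
  obtain ⟨L₁, hL₁⟩ := H (Insert.insert p' (F₁.biUnion R)) (by
    intro q hq
    rcases Finset.mem_insert.1 hq with rfl | hq
    · exact hp'
    · obtain ⟨r, hr, hq⟩ := Finset.mem_biUnion.1 hq
      exact (hR r q hq).trans_le (hF₁d r hr))
  refine ⟨Insert.insert p.leadingCoeff (L₀ ∪ (L₁ ∪ F₁.biUnion C)), fun x x' hxx => ?_⟩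
  have hlc := hxx _ (Finset.mem_insert_self _ _)
  have hx0 : ∀ a ∈ L₀, SignType.sign (x a) = SignType.sign (x' a) := fun a ha =>
    hxx a (Finset.mem_insert_of_mem (Finset.mem_union_left _ ha))
  have hx1 : ∀ a ∈ L₁, SignType.sign (x a) = SignType.sign (x' a) := fun a ha =>
    hxx a (Finset.mem_insert_of_mem (Finset.mem_union_right _ (Finset.mem_union_left _ ha)))
  have hx2 : ∀ q ∈ F₁, ∀ a ∈ C q, SignType.sign (x a) = SignType.sign (x' a) := fun q hq a ha =>
    hxx a (Finset.mem_insert_of_mem (Finset.mem_union_right _ (Finset.mem_union_right _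
      (Finset.mem_biUnion.2 ⟨q, hq, ha⟩))))
  by_cases hx : x p.leadingCoeff = 0
  · have hx' : x' p.leadingCoeff = 0 := by
      rcases sign_eq_sign_cases hlc with h | h | h <;> linarith
    obtain ⟨φ, hφ⟩ := hL₀ x x' hx0
    refine ⟨φ, fun q hq t => ?_⟩
    rcases Finset.mem_insert.1 hq with rfl | hq
    · rw [← eval₂_eraseLead_of_map_leadingCoeff_eq_zero hx,
        ← eval₂_eraseLead_of_map_leadingCoeff_eq_zero hx']
      exact hφ _ (Finset.mem_union_right _ (Finset.mem_singleton_self _)) t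
    · exact hφ q (Finset.mem_union_left _ hq) t
  · obtain ⟨φ, hφ⟩ := hL₁ x x' hx1
    have hφF : ∀ q ∈ F₁, ∀ t,
        SignType.sign (q.eval₂ x t) = SignType.sign (q.eval₂ x' (φ t)) := by
      intro q hq
      rcases Finset.mem_insert.1 hq with rfl | hq
      · exact hφ _ (Finset.mem_union_right _ (Finset.mem_insert_self _ _))
      · exact hφ _ (Finset.mem_union_left _ hq)
    obtain ⟨ψ, hψ⟩ := exists_orderIso_sign_eval₂_eq hφF (Finset.mem_insert_self _ _) hpos hlc hx
      (by
        intro q hq hq0 t ht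
        have ht' : q.eval₂ x' (φ t) = 0 := by
          have := hφF q hq t
          rwa [ht, sign_zero, eq_comm, sign_eq_zero_iff] at this
        exact hRC q x x' t (φ t) (hx2 q hq) hq0 ht ht' fun r hr =>
          hφ r (Finset.mem_union_right _ (Finset.mem_insert_of_mem
            (Finset.mem_biUnion.2 ⟨q, hq, hr⟩))) t)
    refine ⟨ψ, fun q hq t => hψ q ?_ t⟩
    rcases Finset.mem_insert.1 hq with rfl | hq
    · exact Set.mem_insert _ _
    · exact Set.mem_insert_of_mem _ (Finset.mem_coe.2 (Finset.mem_insert_of_mem hq))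

theorem signsDetermined (F : Finset (Polynomial A)) : SignsDetermined F := by
  classical
  suffices h : ∀ d, ∀ F : Finset (Polynomial A), (∀ q ∈ F, q.natDegree < d) →
      SignsDetermined F from
    h (F.sup Polynomial.natDegree + 1) F fun q hq => Nat.lt_succ_of_le (Finset.le_sup hq)
  intro d
  induction d with
  | zero =>
    intro F hF
    exact ⟨∅, fun x x' _ => ⟨OrderIso.refl ℝ, fun q hq => absurd (hF q hq) (by simp)⟩⟩
  | succ d ih =>
    have aux : ∀ M : Finset (Polynomial A), (∀ q ∈ M, q.natDegree = d) →
        ∀ F : Finset (Polynomial A), (∀ q ∈ F, q.natDegree < d) → SignsDetermined (F ∪ M) := by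
      intro M
      induction M using Finset.induction_on with
      | empty => intro _ F hF; simpa using ih F hF
      | insert p M _ ihM =>
        intro hM F hF
        have hpd : p.natDegree = d := hM p (Finset.mem_insert_self _ _)
        have hMd : ∀ q ∈ M, q.natDegree = d := fun q hq => hM q (Finset.mem_insert_of_mem hq)
        rw [Finset.union_insert]
        refine SignsDetermined.insert (fun q hq => ?_) fun F' hF' => ?_
        · rcases Finset.mem_union.1 hq with hq | hq
          · exact hpd ▸ (hF q hq).le
          · exact hpd ▸ (hMd q hq).le
        · rw [Finset.union_right_comm]
          refine ihM hMd (F ∪ F') fun q hq => ?_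
          rcases Finset.mem_union.1 hq with hq | hq
          · exact hF q hq
          · exact hpd ▸ hF' q hq
    intro F hF
    have hsplit : F = F.filter (fun q => q.natDegree < d) ∪ F.filter (fun q => q.natDegree = d) := by
      ext q
      simp only [Finset.mem_union, Finset.mem_filter]
      constructor
      · intro hq
        have := hF q hq
        rcases Nat.lt_or_ge q.natDegree d with h | h
        · exact Or.inl ⟨hq, h⟩
        · exact Or.inr ⟨hq, by omega⟩
      · rintro (h | h) <;> exact h.1
    rw [hsplit]
    exact aux _ (by simp) _ (by simp)

end Param

/-! ### Polynomial functions -/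

/-- A real-valued polynomial function of the coordinates. -/
def IsPolyFun {ι : Type*} (g : (ι → ℝ) → ℝ) : Prop :=
  ∃ p : MvPolynomial ι ℝ, ∀ x, g x = MvPolynomial.eval x p

namespace IsPolyFun

variable {ι κ : Type*} {g h : (ι → ℝ) → ℝ}

theorem const (c : ℝ) : IsPolyFun fun _ : ι → ℝ => c := ⟨MvPolynomial.C c, by simp⟩

theorem coord (i : ι) : IsPolyFun fun x : ι → ℝ => x i := ⟨MvPolynomial.X i, by simp⟩

theorem add (hg : IsPolyFun g) (hh : IsPolyFun h) : IsPolyFun fun x => g x + h x := by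
  obtain ⟨p, hp⟩ := hg
  obtain ⟨q, hq⟩ := hh
  exact ⟨p + q, by simp [hp, hq]⟩

theorem mul (hg : IsPolyFun g) (hh : IsPolyFun h) : IsPolyFun fun x => g x * h x := by
  obtain ⟨p, hp⟩ := hg
  obtain ⟨q, hq⟩ := hh
  exact ⟨p * q, by simp [hp, hq]⟩

theorem neg (hg : IsPolyFun g) : IsPolyFun fun x => -g x := by
  obtain ⟨p, hp⟩ := hg
  exact ⟨-p, by simp [hp]⟩

theorem sub (hg : IsPolyFun g) (hh : IsPolyFun h) : IsPolyFun fun x => g x - h x := by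
  simpa only [sub_eq_add_neg] using hg.add hh.neg

theorem pow (hg : IsPolyFun g) (k : ℕ) : IsPolyFun fun x => g x ^ k := by
  obtain ⟨p, hp⟩ := hg
  exact ⟨p ^ k, by simp [hp]⟩

theorem sum {σ : Type*} {s : Finset σ} {g : σ → (ι → ℝ) → ℝ} (hg : ∀ i ∈ s, IsPolyFun (g i)) :
    IsPolyFun fun x => ∑ i ∈ s, g i x := by
  classical
  induction s using Finset.induction_on with
  | empty => simpa using const 0
  | insert a s ha ih =>
    simp only [Finset.sum_insert ha]
    exact (hg a (Finset.mem_insert_self _ _)).add (ih fun i hi => hg i (Finset.mem_insert_of_mem hi))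

theorem comp (hg : IsPolyFun g) {F : (κ → ℝ) → ι → ℝ} (hF : ∀ i, IsPolyFun fun x => F x i) :
    IsPolyFun fun x => g (F x) := by
  obtain ⟨p, hp⟩ := hg
  choose q hq using hF
  refine ⟨MvPolynomial.bind₁ q p, fun x => ?_⟩
  refine (hp (F x)).trans ?_
  rw [show F x = fun i => MvPolynomial.eval x (q i) from funext fun i => hq i x]
  exact (MvPolynomial.eval₂Hom_bind₁ _ _ _ _).symm

end IsPolyFun

/-! ### Sets determined by finitely many signs, and quantifier elimination -/

/-- Membership in `S` depends only on the signs of finitely many polynomials. -/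
def SignDet {ι : Type*} (S : Set (ι → ℝ)) : Prop :=
  ∃ L : Finset (MvPolynomial ι ℝ), ∀ x x' : ι → ℝ,
    (∀ p ∈ L, SignType.sign (MvPolynomial.eval x p) = SignType.sign (MvPolynomial.eval x' p)) →
      x ∈ S → x' ∈ S

namespace SignDet

variable {ι κ : Type*} {S T : Set (ι → ℝ)}

theorem compl (hS : SignDet S) : SignDet Sᶜ := by
  obtain ⟨L, hL⟩ := hS
  exact ⟨L, fun x x' h hx hx' => hx (hL x' x (fun p hp => (h p hp).symm) hx')⟩

theorem inter (hS : SignDet S) (hT : SignDet T) : SignDet (S ∩ T) := by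
  classical
  obtain ⟨L, hL⟩ := hS
  obtain ⟨M, hM⟩ := hT
  exact ⟨L ∪ M, fun x x' h hx =>
    ⟨hL x x' (fun p hp => h p (Finset.mem_union_left _ hp)) hx.1,
      hM x x' (fun p hp => h p (Finset.mem_union_right _ hp)) hx.2⟩⟩

theorem imp {p q : (ι → ℝ) → Prop} (hp : SignDet {x | p x}) (hq : SignDet {x | q x}) :
    SignDet {x | p x → q x} := by
  have h : {x | p x → q x} = ({x | p x} ∩ {x | q x}ᶜ)ᶜ := by
    ext x
    simp
  rw [h]
  exact (hp.inter hq.compl).compl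

theorem le {g h : (ι → ℝ) → ℝ} (hg : IsPolyFun g) (hh : IsPolyFun h) : SignDet {x | g x ≤ h x} := by
  obtain ⟨p, hp⟩ := hh.sub hg
  refine ⟨{p}, fun x x' hs (hx : g x ≤ h x) => show g x' ≤ h x' from ?_⟩
  have := sign_eq_sign_cases (hs p (Finset.mem_singleton_self _))
  rw [← hp, ← hp] at this
  rcases this with h | h | h <;> linarith

theorem eq {g h : (ι → ℝ) → ℝ} (hg : IsPolyFun g) (hh : IsPolyFun h) : SignDet {x | g x = h x} := by
  have : {x | g x = h x} = {x | g x ≤ h x} ∩ {x | h x ≤ g x} := by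
    ext x
    exact le_antisymm_iff
  rw [this]
  exact (le hg hh).inter (le hh hg)

theorem preimage (hS : SignDet S) {F : (κ → ℝ) → ι → ℝ} (hF : ∀ i, IsPolyFun fun x => F x i) :
    SignDet {x | F x ∈ S} := by
  classical
  obtain ⟨L, hL⟩ := hS
  choose f hf using fun p : MvPolynomial ι ℝ => IsPolyFun.comp ⟨p, fun _ => rfl⟩ hF
  refine ⟨L.image f, fun x x' h => hL _ _ fun p hp => ?_⟩
  exact (congrArg _ (hf p x)).trans
    ((h _ (Finset.mem_image_of_mem f hp)).trans (congrArg _ (hf p x')).symm)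

theorem exists_update [DecidableEq ι] (hS : SignDet S) (i : ι) :
    SignDet {x | ∃ t, Function.update x i t ∈ S} := by
  classical
  obtain ⟨L, hL⟩ := hS
  let h : MvPolynomial ι ℝ →+* Polynomial (MvPolynomial ι ℝ) :=
    MvPolynomial.eval₂Hom (Polynomial.C.comp MvPolynomial.C)
      fun j => if j = i then Polynomial.X else Polynomial.C (MvPolynomial.X j)
  have hh : ∀ (x : ι → ℝ) (t : ℝ) (p : MvPolynomial ι ℝ),
      (h p).eval₂ (MvPolynomial.eval x) t = MvPolynomial.eval (Function.update x i t) p := by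
    intro x t p
    have : (Polynomial.eval₂RingHom (MvPolynomial.eval x) t).comp h =
        MvPolynomial.eval (Function.update x i t) := by
      refine MvPolynomial.ringHom_ext (fun r => ?_) fun j => ?_
      · simp [h]
      · by_cases hj : j = i
        · subst hj
          simp [h]
        · simp [h, hj]
    exact congrArg (fun f => f p) this
  obtain ⟨M, hM⟩ := signsDetermined (L.image h)
  refine ⟨M, fun x x' hx => ?_⟩
  obtain ⟨φ, hφ⟩ := hM (MvPolynomial.eval x) (MvPolynomial.eval x') hx
  rintro ⟨t, ht⟩
  refine ⟨φ t, hL _ _ (fun p hp => ?_) ht⟩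
  rw [← hh, ← hh]
  exact hφ _ (Finset.mem_image_of_mem h hp) t

theorem exists_finset (hS : SignDet S) (J : Finset ι) :
    SignDet {x | ∃ y : ι → ℝ, (∀ j ∉ J, y j = x j) ∧ y ∈ S} := by
  classical
  induction J using Finset.induction_on with
  | empty =>
    convert hS using 1
    ext x
    constructor
    · rintro ⟨y, hy, hyS⟩
      rwa [show x = y from funext fun j => (hy j (by simp)).symm]
    · exact fun hx => ⟨x, fun _ _ => rfl, hx⟩
  | insert i J hi ih =>
    convert ih.exists_update i using 1
    ext x
    constructor
    · rintro ⟨y, hy, hyS⟩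
      refine ⟨y i, y, fun j hj => ?_, hyS⟩
      by_cases hji : j = i
      · rw [hji, Function.update_self]
      · rw [Function.update_of_ne hji, hy j (by simp [hji, hj])]
    · rintro ⟨t, y, hy, hyS⟩
      refine ⟨y, fun j hj => ?_, hyS⟩
      rw [Finset.mem_insert, not_or] at hj
      rw [hy j hj.2, Function.update_of_ne hj.1]

/-- The projection theorem. -/
theorem exists_sumElim [Fintype κ] {S : Set (ι ⊕ κ → ℝ)} (hS : SignDet S) :
    SignDet {x : ι → ℝ | ∃ y : κ → ℝ, Sum.elim x y ∈ S} := by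
  classical
  have h := (hS.exists_finset (Finset.univ.map ⟨Sum.inr, Sum.inr_injective⟩)).preimage
    (F := fun x : ι → ℝ => Sum.elim x fun _ => 0)
    (by rintro (i | k); exacts [IsPolyFun.coord i, IsPolyFun.const 0])
  convert h using 1
  ext x
  constructor
  · rintro ⟨y, hy⟩
    refine ⟨Sum.elim x y, ?_, hy⟩
    rintro (i | k) hj
    · rfl
    · simp at hj
  · rintro ⟨y, hy, hyS⟩
    refine ⟨y ∘ Sum.inr, ?_⟩
    convert hyS using 1
    funext j
    rcases j with i | k
    · exact (hy (Sum.inl i) (by simp)).symm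
    · rfl

theorem forall_sumElim [Fintype κ] {S : Set (ι ⊕ κ → ℝ)} (hS : SignDet S) :
    SignDet {x : ι → ℝ | ∀ y : κ → ℝ, Sum.elim x y ∈ S} := by
  have := hS.compl.exists_sumElim.compl
  convert this using 1
  ext x
  simp

end SignDet

theorem IsSemialgebraic.signDet {ι : Type} [Fintype ι] {S : Set (ι → ℝ)}
    (hS : IsSemialgebraic S) : SignDet S := by
  classical
  obtain ⟨N, T, hT, rfl⟩ := hS
  choose p k q hT using hT
  refine ⟨Finset.univ.biUnion fun i => insert (p i) (Finset.univ.image (q i)),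
    fun x x' h hx => ?_⟩
  obtain ⟨i, hi⟩ := mem_iUnion.1 hx
  refine mem_iUnion.2 ⟨i, ?_⟩
  have h' : ∀ r ∈ insert (p i) (Finset.univ.image (q i)),
      SignType.sign (MvPolynomial.eval x r) = SignType.sign (MvPolynomial.eval x' r) :=
    fun r hr => h r (Finset.mem_biUnion.2 ⟨i, Finset.mem_univ _, hr⟩)
  rw [hT i] at hi ⊢
  refine ⟨?_, fun j => ?_⟩
  · have := h' _ (Finset.mem_insert_self _ _)
    rwa [hi.1, sign_zero, eq_comm, sign_eq_zero_iff] at this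
  · have := h' _ (Finset.mem_insert_of_mem (Finset.mem_image_of_mem _ (Finset.mem_univ j)))
    rwa [sign_pos (hi.2 j), eq_comm, sign_eq_one_iff] at this

theorem isBasicSemialgebraic_signs {ι : Type} [Fintype ι] {κ : Type*} [Fintype κ]
    (q : κ → MvPolynomial ι ℝ) (σ : κ → SignType) :
    IsBasicSemialgebraic {x | ∀ j, SignType.sign (MvPolynomial.eval x (q j)) = σ j} := by
  classical
  let e := Fintype.equivFin {j // σ j ≠ 0}
  refine ⟨∑ j with σ j = 0, q j ^ 2, _, fun i => MvPolynomial.C (σ (e.symm i).1 : ℝ) *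
    q (e.symm i).1, ?_⟩
  ext x
  simp only [mem_ofPred_eq, map_sum, map_pow, map_mul, MvPolynomial.eval_C]
  rw [Finset.sum_eq_zero_iff_of_nonneg fun _ _ => sq_nonneg _]
  have hpos : ∀ (s : SignType), s ≠ 0 → ∀ r : ℝ, 0 < (s : ℝ) * r ↔ SignType.sign r = s := by
    intro s hs r
    cases s with
    | zero => exact absurd rfl hs
    | neg => simpa using (sign_eq_neg_one_iff (a := r)).symm
    | pos => simpa using (sign_eq_one_iff (a := r)).symm
  constructor
  · intro h
    refine ⟨fun j hj => ?_, fun i => ?_⟩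
    · have h0 := (Finset.mem_filter.1 hj).2
      rw [← h j, sign_eq_zero_iff] at h0
      simp [h0]
    · rw [hpos _ (e.symm i).2]
      exact h _
  · rintro ⟨h1, h2⟩ j
    by_cases hj : σ j = 0
    · rw [hj, sign_eq_zero_iff]
      simpa using h1 j (by simp [hj])
    · have := h2 (e ⟨j, hj⟩)
      rw [Equiv.symm_apply_apply] at this
      exact (hpos _ hj _).1 this

theorem SignDet.isSemialgebraic {ι : Type} [Fintype ι] {S : Set (ι → ℝ)}
    (hS : SignDet S) : IsSemialgebraic S := by
  classical
  obtain ⟨L, hL⟩ := hS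
  let cell : (L → SignType) → Set (ι → ℝ) := fun σ =>
    {x | ∀ j : L, SignType.sign (MvPolynomial.eval x j.1) = σ j}
  let e := Fintype.equivFin {σ : L → SignType // ∃ x ∈ S, x ∈ cell σ}
  refine ⟨_, fun i => cell (e.symm i).1, fun i => isBasicSemialgebraic_signs _ _, ?_⟩
  ext x
  rw [mem_iUnion]
  constructor
  · intro hx
    refine ⟨e ⟨fun j => SignType.sign (MvPolynomial.eval x j.1), x, hx, fun _ => rfl⟩, ?_⟩
    rw [Equiv.symm_apply_apply]
    exact fun _ => rfl
  · rintro ⟨i, hi⟩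
    obtain ⟨y, hy, hyc⟩ := (e.symm i).2
    exact hL y x (fun p hp => (hyc ⟨p, hp⟩).trans (hi ⟨p, hp⟩).symm) hy

/-! ### Polynomial growth -/

theorem Polynomial.eventually_abs_eval_le_pow (u : Polynomial ℝ) {k : ℕ} (hk : u.natDegree < k) :
    ∀ᶠ r in Filter.atTop, |u.eval r| ≤ r ^ k := by
  have h : u.degree < (Polynomial.X ^ k : Polynomial ℝ).degree := by
    rw [Polynomial.degree_X_pow]
    exact Polynomial.degree_le_natDegree.trans_lt (by exact_mod_cast hk)
  filter_upwards [(Polynomial.isLittleO_atTop_of_degree_lt _ _ h).bound one_pos,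
    Filter.eventually_ge_atTop 0] with r hr hr0
  simpa [abs_of_nonneg hr0] using hr

theorem Polynomial.eventually_one_le_mul_abs_eval {u : Polynomial ℝ} (hu : u ≠ 0) :
    ∀ᶠ r in Filter.atTop, 1 ≤ r * |u.eval r| := by
  have h : (1 : Polynomial ℝ).degree < (Polynomial.X * u).degree := by
    rw [Polynomial.degree_one, Polynomial.degree_mul, Polynomial.degree_X,
      Polynomial.degree_eq_natDegree hu]
    exact_mod_cast (by omega : 0 < 1 + u.natDegree)
  filter_upwards [(Polynomial.isLittleO_atTop_of_degree_lt _ _ h).bound one_pos,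
    Filter.eventually_ge_atTop 0] with r hr hr0
  simpa [abs_of_nonneg hr0, abs_mul] using hr

/-- Beyond a power of `r`, the polynomial `P (r, ·)` has constant sign, for large `r`. -/
theorem exists_eventually_sign_eval₂_eq (P : Polynomial (Polynomial ℝ)) :
    ∃ K : ℕ, ∀ᶠ r : ℝ in Filter.atTop, ∀ b b' : ℝ, r ^ K ≤ b → r ^ K ≤ b' →
      SignType.sign (P.eval₂ (Polynomial.evalRingHom r) b) =
        SignType.sign (P.eval₂ (Polynomial.evalRingHom r) b') := by
  by_cases hP : P = 0
  · exact ⟨0, by simp [hP]⟩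
  have hlc : P.leadingCoeff ≠ 0 := Polynomial.leadingCoeff_ne_zero.2 hP
  set k := (Finset.range P.natDegree).sup (fun i => (P.coeff i).natDegree) + 1 with hk
  refine ⟨k + 2, ?_⟩
  have hcoeff : ∀ᶠ r : ℝ in Filter.atTop, ∀ i ∈ Finset.range P.natDegree,
      |(P.coeff i).eval r| ≤ r ^ k := by
    rw [Filter.eventually_all_finset]
    intro i hi
    refine Polynomial.eventually_abs_eval_le_pow _ (Nat.lt_succ_of_le ?_)
    exact Finset.le_sup (f := fun i => (P.coeff i).natDegree) hi
  filter_upwards [hcoeff, Polynomial.eventually_one_le_mul_abs_eval hlc,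
    Filter.eventually_ge_atTop 2] with r hc hl hr b b' hb hb'
  have ha : Polynomial.evalRingHom r P.leadingCoeff ≠ 0 := by
    intro h
    rw [Polynomial.coe_evalRingHom] at h
    rw [h] at hl
    norm_num at hl
  set p := P.map (Polynomial.evalRingHom r) with hp
  have hpd : p.natDegree = P.natDegree := Polynomial.natDegree_map_of_leadingCoeff_ne_zero _ ha
  have hpl : p.leadingCoeff = P.leadingCoeff.eval r :=
    Polynomial.leadingCoeff_map_of_leadingCoeff_ne_zero _ ha
  have hp0 : p ≠ 0 := fun h => by
    rw [h, Polynomial.leadingCoeff_zero] at hpl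
    exact ha hpl.symm
  have hrk : (1 : ℝ) ≤ r ^ k := one_le_pow₀ (by linarith)
  have hbound : (p.cauchyBound : ℝ) ≤ r ^ (k + 2) := by
    have hla : 0 < |P.leadingCoeff.eval r| := abs_pos.2 ha
    have hr0 : 0 ≤ r ^ (k + 1) := by positivity
    have h1 : p.cauchyBound ≤ Real.toNNReal (r ^ (k + 1)) + 1 := by
      refine add_le_add_left ?_ 1
      rw [div_le_iff₀ (by simpa [hpl] using ha)]
      refine Finset.sup_le fun i hi => ?_
      rw [hpd] at hi
      rw [← NNReal.coe_le_coe]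
      rw [hpl]
      simp only [coe_nnnorm, NNReal.coe_mul, Real.coe_toNNReal _ hr0, hp, Polynomial.coeff_map,
        Polynomial.coe_evalRingHom, Real.norm_eq_abs]
      calc |(P.coeff i).eval r| ≤ r ^ k * 1 := by rw [mul_one]; exact hc i hi
        _ ≤ r ^ k * (r * |P.leadingCoeff.eval r|) := by gcongr
        _ = r ^ (k + 1) * |P.leadingCoeff.eval r| := by ring
    have h2 : (p.cauchyBound : ℝ) ≤ r ^ (k + 1) + 1 := by
      rw [← NNReal.coe_le_coe, NNReal.coe_add, Real.coe_toNNReal _ hr0] at h1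
      exact h1
    have h3 : (1 : ℝ) ≤ r ^ (k + 1) := one_le_pow₀ (by linarith)
    calc (p.cauchyBound : ℝ) ≤ r ^ (k + 1) + 1 := h2
      _ ≤ r ^ (k + 1) * 2 := by linarith
      _ ≤ r ^ (k + 1) * r := by gcongr
      _ = r ^ (k + 2) := by ring
  rw [← Polynomial.eval_map, ← Polynomial.eval_map]
  refine sign_eq_of_forall_ne_zero p.continuous fun z hz hz0 => ?_
  have h1 := Polynomial.IsRoot.norm_lt_cauchyBound hp0 hz0
  have h2 : ‖z‖ < p.cauchyBound := by exact_mod_cast h1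
  have h3 : r ^ (k + 2) ≤ z := (le_min hb hb').trans hz.1
  linarith [Real.le_norm_self z]

theorem SignDet.exists_eventually_mem_iff {S : Set (Fin 2 → ℝ)} (hS : SignDet S) :
    ∃ K : ℕ, ∀ᶠ r : ℝ in Filter.atTop, ∀ b b' : ℝ, r ^ K ≤ b → r ^ K ≤ b' →
      ![r, b] ∈ S → ![r, b'] ∈ S := by
  classical
  obtain ⟨L, hL⟩ := hS
  let h : MvPolynomial (Fin 2) ℝ →+* Polynomial (Polynomial ℝ) :=
    MvPolynomial.eval₂Hom (Polynomial.C.comp Polynomial.C)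
      ![Polynomial.C Polynomial.X, Polynomial.X]
  have hh : ∀ (r b : ℝ) (p : MvPolynomial (Fin 2) ℝ),
      (h p).eval₂ (Polynomial.evalRingHom r) b = MvPolynomial.eval ![r, b] p := by
    intro r b p
    have : (Polynomial.eval₂RingHom (Polynomial.evalRingHom r) b).comp h =
        MvPolynomial.eval ![r, b] := by
      refine MvPolynomial.ringHom_ext (fun c => ?_) fun j => ?_
      · simp [h]
      · fin_cases j <;> simp [h]
    exact congrArg (fun f => f p) this
  choose K hK using fun p => exists_eventually_sign_eval₂_eq (h p)
  refine ⟨L.sup K, ?_⟩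
  have hall : ∀ᶠ r : ℝ in Filter.atTop, ∀ p ∈ L, ∀ b b' : ℝ, r ^ K p ≤ b → r ^ K p ≤ b' →
      SignType.sign ((h p).eval₂ (Polynomial.evalRingHom r) b) =
        SignType.sign ((h p).eval₂ (Polynomial.evalRingHom r) b') :=
    (Filter.eventually_all_finset L).2 fun p _ => hK p
  filter_upwards [hall, Filter.eventually_ge_atTop 1] with r hr hr1 b b' hb hb'
  refine hL _ _ fun p hp => ?_
  have hle : r ^ K p ≤ r ^ L.sup K := pow_le_pow_right₀ hr1 (Finset.le_sup hp)
  rw [← hh, ← hh]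
  exact hr p hp b b' (hle.trans hb) (hle.trans hb')

theorem isCompact_sum_sq_le {ι : Type*} [Fintype ι] (r : ℝ) :
    IsCompact {x : ι → ℝ | ∑ i, x i ^ 2 ≤ r} := by
  refine Metric.isCompact_of_isClosed_isBounded
    (isClosed_le (by fun_prop) continuous_const) ?_
  refine (Metric.isBounded_Icc (fun _ => -(r + 1)) (fun _ => r + 1)).subset fun x hx => ?_
  have h : ∀ i, x i ^ 2 ≤ r := fun i =>
    (Finset.single_le_sum (f := fun i => x i ^ 2) (fun _ _ => sq_nonneg _)
      (Finset.mem_univ i)).trans hx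
  exact ⟨fun i => show -(r + 1) ≤ x i by nlinarith [h i], fun i => show x i ≤ r + 1 by
    nlinarith [h i]⟩

theorem IsSemialgebraicFun.exists_abs_le {n : ℕ} {f : (Fin n → ℝ) → ℝ}
    (hsa : IsSemialgebraicFun f)
    (hcb : ∀ C : Set (Fin n → ℝ), IsCompact C → ∃ K : ℝ, ∀ x ∈ C, |f x| ≤ K) :
    ∃ (C : ℝ) (k : ℕ), 0 < C ∧ ∀ x, |f x| ≤ C * (1 + ∑ i, x i ^ 2) ^ k := by
  have hG : SignDet {z : Fin n ⊕ Unit → ℝ | f (z ∘ Sum.inl) = z (Sum.inr ())} := hsa.signDet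
  let S : Set (Fin 2 → ℝ) := {e | ∀ z : Fin n ⊕ Unit → ℝ, Sum.elim e z ∈
    {w : Fin 2 ⊕ (Fin n ⊕ Unit) → ℝ | f (fun i => w (Sum.inr (Sum.inl i))) =
        w (Sum.inr (Sum.inr ())) → ∑ i, w (Sum.inr (Sum.inl i)) ^ 2 ≤ w (Sum.inl 0) →
      (w (Sum.inr (Sum.inr ())) ≤ w (Sum.inl 1) ∧
        -w (Sum.inr (Sum.inr ())) ≤ w (Sum.inl 1))}}
  have hS : SignDet S := by
    refine SignDet.forall_sumElim (SignDet.imp ?_ (SignDet.imp (SignDet.le ?_ ?_)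
      ((SignDet.le ?_ ?_).inter (SignDet.le ?_ ?_))))
    · exact hG.preimage (F := fun w j => w (Sum.inr j)) fun j => IsPolyFun.coord _
    · exact IsPolyFun.sum fun i _ => (IsPolyFun.coord _).pow 2
    · exact IsPolyFun.coord _
    · exact IsPolyFun.coord _
    · exact IsPolyFun.coord _
    · exact (IsPolyFun.coord _).neg
    · exact IsPolyFun.coord _
  have mem_S : ∀ r b : ℝ, ![r, b] ∈ S ↔ ∀ x : Fin n → ℝ, ∑ i, x i ^ 2 ≤ r → |f x| ≤ b := by
    intro r b
    constructor
    · intro h x hx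
      have := h (Sum.elim x fun _ => f x) rfl hx
      exact abs_le'.2 this
    · intro h z hz hr
      have := abs_le'.1 (h _ hr)
      rw [hz] at this
      exact this
  obtain ⟨K, hK⟩ := hS.exists_eventually_mem_iff
  obtain ⟨R, hR⟩ := Filter.eventually_atTop.1 hK
  obtain ⟨B, hB⟩ := hcb _ (isCompact_sum_sq_le (max R 0))
  refine ⟨max B 1, K, by positivity, fun x => ?_⟩
  have hs : 0 ≤ ∑ i, x i ^ 2 := Finset.sum_nonneg fun _ _ => sq_nonneg _
  have h1 : (1 : ℝ) ≤ (1 + ∑ i, x i ^ 2) ^ K := one_le_pow₀ (by linarith)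
  rcases le_total (∑ i, x i ^ 2) (max R 0) with hx | hx
  · calc |f x| ≤ B := hB x hx
      _ ≤ max B 1 * 1 := by rw [mul_one]; exact le_max_left _ _
      _ ≤ _ := by gcongr
  · set r := ∑ i, x i ^ 2 with hr
    obtain ⟨b, hb⟩ := hcb _ (isCompact_sum_sq_le r)
    have hmem : ![r, max b (r ^ K)] ∈ S :=
      (mem_S _ _).2 fun y hy => (hb y hy).trans (le_max_left _ _)
    have hmem' := hR r ((le_max_left _ _).trans hx) _ (r ^ K) (le_max_right _ _) le_rfl hmem
    calc |f x| ≤ r ^ K := (mem_S _ _).1 hmem' x hr.ge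
      _ ≤ 1 * (1 + r) ^ K := by
        rw [one_mul]
        gcongr
        linarith
      _ ≤ _ := by gcongr; exact le_max_right _ _

/-! ### The compact convex set of the construction -/

theorem SignDet.dualCone_dualCone {ι κ : Type*} [Fintype ι] [Fintype κ] {G : Set (κ → ℝ)}
    (hG : SignDet G) {F : (κ → ℝ) → ι → ℝ} (hF : ∀ i, IsPolyFun fun w => F w i) :
    SignDet {y : ι → ℝ | ∀ c : ι → ℝ, (∀ w ∈ G, 0 ≤ c ⬝ᵥ F w) → 0 ≤ c ⬝ᵥ y} := by
  have hc : SignDet {c : ι → ℝ | ∀ w : κ → ℝ, Sum.elim c w ∈ {v : ι ⊕ κ → ℝ |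
      (fun k => v (Sum.inr k)) ∈ G →
        0 ≤ ∑ i, v (Sum.inl i) * F (fun k => v (Sum.inr k)) i}} := by
    refine SignDet.forall_sumElim (SignDet.imp ?_ (SignDet.le (IsPolyFun.const 0) ?_))
    · exact hG.preimage (F := fun v k => v (Sum.inr k)) fun k => IsPolyFun.coord _
    · exact IsPolyFun.sum fun i _ => (IsPolyFun.coord _).mul
        ((hF i).comp (F := fun v k => v (Sum.inr k)) fun k => IsPolyFun.coord _)
  have h : SignDet {y : ι → ℝ | ∀ c : ι → ℝ, Sum.elim y c ∈ {v : ι ⊕ ι → ℝ |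
      (fun k => v (Sum.inr k)) ∈ {c : ι → ℝ | ∀ w : κ → ℝ, Sum.elim c w ∈ {v : ι ⊕ κ → ℝ |
        (fun k => v (Sum.inr k)) ∈ G →
          0 ≤ ∑ i, v (Sum.inl i) * F (fun k => v (Sum.inr k)) i}} →
        0 ≤ ∑ i, v (Sum.inr i) * v (Sum.inl i)}} := by
    refine SignDet.forall_sumElim (SignDet.imp ?_ (SignDet.le (IsPolyFun.const 0) ?_))
    · exact hc.preimage (F := fun v k => v (Sum.inr k)) fun k => IsPolyFun.coord _
    · exact IsPolyFun.sum fun i _ => (IsPolyFun.coord _).mul (IsPolyFun.coord _)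
  exact h

theorem isClosed_dualCone_dualCone {ι : Type*} [Fintype ι] (S : Set (ι → ℝ)) :
    IsClosed {y : ι → ℝ | ∀ c : ι → ℝ, (∀ w ∈ S, 0 ≤ c ⬝ᵥ w) → 0 ≤ c ⬝ᵥ y} := by
  simp only [ofPred_forall]
  refine isClosed_iInter fun c => isClosed_iInter fun _ => isClosed_le continuous_const ?_
  unfold dotProduct
  fun_prop

theorem convex_dualCone_dualCone {ι : Type*} [Fintype ι] (S : Set (ι → ℝ)) :
    Convex ℝ {y : ι → ℝ | ∀ c : ι → ℝ, (∀ w ∈ S, 0 ≤ c ⬝ᵥ w) → 0 ≤ c ⬝ᵥ y} := by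
  intro y hy y' hy' a b ha hb _ c hc
  rw [dotProduct_add, dotProduct_smul, dotProduct_smul, smul_eq_mul, smul_eq_mul]
  exact add_nonneg (mul_nonneg ha (hy c hc)) (mul_nonneg hb (hy' c hc))

theorem dotProduct_append_three {n : ℕ} (u : Fin n → ℝ) (α β γ : ℝ) (y : Fin (n + 3) → ℝ) :
    Fin.append u ![α, β, γ] ⬝ᵥ y = ∑ i, u i * y (Fin.castAdd 3 i) + (α * y (Fin.natAdd n 0) +
      β * y (Fin.natAdd n 1) + γ * y (Fin.natAdd n 2)) := by
  rw [dotProduct, Fin.sum_univ_add]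
  simp only [Fin.append_left, Fin.append_right, Fin.sum_univ_three]
  rfl

/-- An upper semicontinuous function of growth at most `N ≤ A M (1 + |z|²)` is dominated, up to a
small multiple of `N`, by its value at `x` and a penalty that vanishes at `x`. -/
theorem UpperSemicontinuous.exists_le_add_penalty {n : ℕ} {f M : (Fin n → ℝ) → ℝ}
    (husc : UpperSemicontinuous f) (hM : Continuous M) (hM0 : ∀ z, 0 < M z)
    (hf : ∀ z, |f z| ≤ M z * (1 + ∑ i, z i ^ 2)) (x : Fin n → ℝ) {τ : ℝ}
    (hτ : f x < τ * (M x * (1 + ∑ i, x i ^ 2))) :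
    ∃ K : ℝ, ∀ z, f z ≤ τ * (M z * (1 + ∑ i, z i ^ 2)) + K * (M z * ∑ i, (x i - z i) ^ 2) := by
  have hN : Continuous fun z : Fin n → ℝ => τ * (M z * (1 + ∑ i, z i ^ 2)) := by fun_prop
  obtain ⟨q, hq1, hq2⟩ := exists_between hτ
  have hev : ∀ᶠ z in nhds x, f z ≤ τ * (M z * (1 + ∑ i, z i ^ 2)) := by
    filter_upwards [husc x q hq1, hN.continuousAt.eventually_const_lt hq2] with z h1 h2
    exact (h1.trans h2).le
  obtain ⟨δ, hδ, hball⟩ := Metric.eventually_nhds_iff.1 hev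
  set B := (1 + 2 * ∑ i, x i ^ 2) / δ ^ 2 + 2 with hB
  have hx0 : 0 ≤ ∑ i, x i ^ 2 := Finset.sum_nonneg fun _ _ => sq_nonneg _
  have hB0 : 0 ≤ B := by positivity
  refine ⟨(1 + |τ|) * B, fun z => ?_⟩
  have hE0 : 0 ≤ ∑ i, (x i - z i) ^ 2 := Finset.sum_nonneg fun _ _ => sq_nonneg _
  have hz0 : 0 ≤ ∑ i, z i ^ 2 := Finset.sum_nonneg fun _ _ => sq_nonneg _
  have hMz := (hM0 z).le
  by_cases hz : dist z x < δ
  · have := hball hz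
    have h2 : 0 ≤ (1 + |τ|) * B * (M z * ∑ i, (x i - z i) ^ 2) := by positivity
    linarith
  · have hfar : δ ^ 2 ≤ ∑ i, (x i - z i) ^ 2 := by
      by_contra! h
      refine hz ((dist_pi_lt_iff hδ).2 fun i => ?_)
      rw [Real.dist_eq]
      refine abs_lt_of_sq_lt_sq (lt_of_le_of_lt ?_ h) hδ.le
      rw [← neg_sub, neg_sq]
      exact Finset.single_le_sum (f := fun i => (x i - z i) ^ 2) (fun _ _ => sq_nonneg _)
        (Finset.mem_univ i)
    have hsum : ∑ i, z i ^ 2 ≤ 2 * ∑ i, x i ^ 2 + 2 * ∑ i, (x i - z i) ^ 2 := by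
      rw [Finset.mul_sum, Finset.mul_sum, ← Finset.sum_add_distrib]
      exact Finset.sum_le_sum fun i _ => by nlinarith [sq_nonneg (2 * x i - z i)]
    have hD : 1 + ∑ i, z i ^ 2 ≤ B * ∑ i, (x i - z i) ^ 2 := by
      have h1 : 1 + 2 * ∑ i, x i ^ 2 ≤
          (1 + 2 * ∑ i, x i ^ 2) / δ ^ 2 * ∑ i, (x i - z i) ^ 2 := by
        rw [div_mul_eq_mul_div, le_div_iff₀ (by positivity)]
        gcongr
      rw [hB, add_mul]
      linarith
    have h1 : M z * (1 + ∑ i, z i ^ 2) ≤ M z * (B * ∑ i, (x i - z i) ^ 2) := by gcongr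
    have h2 : 0 ≤ M z * (1 + ∑ i, z i ^ 2) := by positivity
    calc f z ≤ M z * (1 + ∑ i, z i ^ 2) := (abs_le.1 (hf z)).2
      _ ≤ τ * (M z * (1 + ∑ i, z i ^ 2)) + (1 + |τ|) * (M z * (1 + ∑ i, z i ^ 2)) := by
        nlinarith [neg_abs_le τ]
      _ ≤ τ * (M z * (1 + ∑ i, z i ^ 2)) + (1 + |τ|) * (M z * (B * ∑ i, (x i - z i) ^ 2)) := by
        gcongr
      _ = _ := by ring

/-- every semi-algebraic, upper semicontinuous function bounded on compact sets
is the pessimistic value function of a polynomial bilevel problem with convex lower-level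
objective over a nonempty compact convex semi-algebraic set. -/
theorem sa_usc_cb_is_compact_convex_pessimistic_value (n : ℕ) (f : (Fin n → ℝ) → ℝ)
    (hsa : IsSemialgebraicFun f) (husc : UpperSemicontinuous f)
    (hcb : ∀ C : Set (Fin n → ℝ), IsCompact C → ∃ K : ℝ, ∀ x ∈ C, |f x| ≤ K) :
    ∃ (m : ℕ) (P Q : (Fin n → ℝ) → (Fin m → ℝ) → ℝ) (Y : Set (Fin m → ℝ)),
      IsPolyMap P ∧ IsPolyMap Q ∧ (∀ x, ConvexOn ℝ Set.univ (Q x)) ∧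
      Y.Nonempty ∧ IsCompact Y ∧ Convex ℝ Y ∧ IsSemialgebraic Y ∧
      ∀ x, valPess P Q Y x = ((f x : ℝ) : EReal) := by
  obtain ⟨C, k, hC, hfC⟩ := hsa.exists_abs_le hcb
  set D : (Fin n → ℝ) → ℝ := fun z => ∑ i, z i ^ 2 with hD
  set M : (Fin n → ℝ) → ℝ := fun z => C * (1 + D z) ^ k with hM
  set lift : (Fin n → ℝ) → ℝ → Fin (n + 3) → ℝ := fun z t =>
    Fin.append (fun i => M z * z i) ![M z, M z * D z, t] with hlift
  set S : Set (Fin (n + 3) → ℝ) := {y | ∀ c : Fin (n + 3) → ℝ,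
    (∀ w ∈ range fun z => lift z (f z), 0 ≤ c ⬝ᵥ w) → 0 ≤ c ⬝ᵥ y} with hS
  set Y : Set (Fin (n + 3) → ℝ) := {y | y (Fin.natAdd n 0) + y (Fin.natAdd n 1) = 1} ∩ S with hY
  have hD0 : ∀ z, 0 ≤ D z := fun z => Finset.sum_nonneg fun _ _ => sq_nonneg _
  have hM0 : ∀ z, 0 < M z := fun z => by have := hD0 z; positivity
  have hN0 : ∀ z, 0 < M z * (1 + D z) := fun z => by have := hD0 z; have := hM0 z; positivity
  have hMc : Continuous M := by fun_prop
  have hfN : ∀ z, |f z| ≤ M z * (1 + D z) := fun z =>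
    (hfC z).trans (le_mul_of_one_le_right (hM0 z).le (by linarith [hD0 z]))
  have hlin : ∀ (u : Fin n → ℝ) (α β γ : ℝ), (∀ z, 0 ≤ M z * ∑ i, u i * z i + (α * M z +
      β * (M z * D z) + γ * f z)) → ∀ y ∈ Y, 0 ≤ ∑ i, u i * y (Fin.castAdd 3 i) +
        (α * y (Fin.natAdd n 0) + β * y (Fin.natAdd n 1) + γ * y (Fin.natAdd n 2)) := by
    intro u α β γ h y hy
    rw [← dotProduct_append_three]
    refine hy.2 _ ?_
    rintro _ ⟨z, rfl⟩
    rw [dotProduct_append_three]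
    simp only [hlift, Fin.append_left, Fin.append_right]
    convert h z using 2
    · rw [Finset.mul_sum]
      exact Finset.sum_congr rfl fun i _ => by ring
    · rfl
  have hκ : ∀ x, (M x * (1 + D x))⁻¹ • lift x (f x) ∈ Y := by
    intro x
    refine ⟨?_, fun c hc => ?_⟩
    · change (M x * (1 + D x))⁻¹ • lift x (f x) (Fin.natAdd n 0) +
        (M x * (1 + D x))⁻¹ • lift x (f x) (Fin.natAdd n 1) = 1
      simp only [hlift, Fin.append_right, smul_eq_mul]
      rw [← mul_add]
      change (M x * (1 + D x))⁻¹ * (M x + M x * D x) = 1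
      rw [← mul_one_add]
      exact inv_mul_cancel₀ (hN0 x).ne'
    · rw [dotProduct_smul]
      exact smul_nonneg (inv_nonneg.2 (hN0 x).le) (hc _ ⟨x, rfl⟩)
  set Q : (Fin n → ℝ) → (Fin (n + 3) → ℝ) → ℝ := fun x y =>
    ∑ i, (-2 * x i) * y (Fin.castAdd 3 i) + (D x * y (Fin.natAdd n 0) +
      1 * y (Fin.natAdd n 1) + 0 * y (Fin.natAdd n 2)) with hQ
  have hexp : ∀ x z : Fin n → ℝ, ∑ i, (x i - z i) ^ 2 = ∑ i, (-2 * x i) * z i + D x + D z := by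
    intro x z
    simp only [hD, ← Finset.sum_add_distrib]
    exact Finset.sum_congr rfl fun i _ => by ring
  have hQ0 : ∀ x, ∀ y ∈ Y, 0 ≤ Q x y := by
    intro x
    refine hlin _ _ _ _ fun z => ?_
    have h : 0 ≤ M z * ∑ i, (x i - z i) ^ 2 :=
      mul_nonneg (hM0 z).le (Finset.sum_nonneg fun _ _ => sq_nonneg _)
    rw [hexp] at h
    linarith
  have hQκ : ∀ x, Q x ((M x * (1 + D x))⁻¹ • lift x (f x)) = 0 := by
    intro x
    rw [hQ]
    simp only [← dotProduct_append_three]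
    rw [dotProduct_smul, dotProduct_append_three]
    simp only [hlift, Fin.append_left, Fin.append_right]
    refine smul_eq_zero_of_right _ ?_
    have h : M x * ∑ i, (x i - x i) ^ 2 = 0 := by simp
    rw [hexp, mul_add, mul_add, Finset.mul_sum] at h
    calc _ = ∑ i, M x * (-2 * x i * x i) + M x * D x + M x * D x := by
          change _ + (D x * M x + 1 * (M x * D x) + 0 * f x) = _
          rw [Finset.sum_congr rfl fun i _ => show -2 * x i * (M x * x i) =
            M x * (-2 * x i * x i) by ring]
          ring
      _ = 0 := h
  have hPle : ∀ x, ∀ y ∈ Y, Q x y = 0 → M x * (1 + D x) * y (Fin.natAdd n 2) ≤ f x := by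
    intro x y hy hQy
    by_contra! hlt
    rw [← div_lt_iff₀' (hN0 x)] at hlt
    obtain ⟨τ, hτ1, hτ2⟩ := exists_between hlt
    rw [div_lt_iff₀ (hN0 x)] at hτ1
    obtain ⟨K, hK⟩ := husc.exists_le_add_penalty hMc hM0 hfN x hτ1
    have h := hlin (fun i => K * (-2 * x i)) (τ + K * D x) (τ + K * 1) (-1) (fun z => by
      have h := hK z
      rw [hexp] at h
      simp only [mul_assoc, ← Finset.mul_sum] at h ⊢
      linarith) y hy
    have h1 : y (Fin.natAdd n 0) + y (Fin.natAdd n 1) = 1 := hy.1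
    simp only [hQ] at hQy
    simp only [mul_assoc K, ← Finset.mul_sum] at h
    have h2 : τ * (y (Fin.natAdd n 0) + y (Fin.natAdd n 1)) = τ := by rw [h1, mul_one]
    have h3 := congrArg (K * ·) hQy
    linarith
  refine ⟨n + 3, fun x y => M x * (1 + D x) * y (Fin.natAdd n 2), Q, Y, ?_, ?_, ?_, ⟨_, hκ 0⟩,
    ?_, ?_, ?_, ?_⟩
  · have hDp : IsPolyFun fun w : Fin n ⊕ Fin (n + 3) → ℝ => D fun i => w (Sum.inl i) :=
      IsPolyFun.sum fun i _ => (IsPolyFun.coord _).pow 2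
    have h1 := (IsPolyFun.const (1 : ℝ)).add hDp
    obtain ⟨p, hp⟩ := (((IsPolyFun.const C).mul (h1.pow k)).mul h1).mul
      (IsPolyFun.coord (Sum.inr (Fin.natAdd n 2)))
    exact ⟨p, fun x y => hp (Sum.elim x y)⟩
  · have hDp : IsPolyFun fun w : Fin n ⊕ Fin (n + 3) → ℝ => D fun i => w (Sum.inl i) :=
      IsPolyFun.sum fun i _ => (IsPolyFun.coord _).pow 2
    have hv : IsPolyFun fun w : Fin n ⊕ Fin (n + 3) → ℝ =>
        ∑ i, (-2 * w (Sum.inl i)) * w (Sum.inr (Fin.castAdd 3 i)) :=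
      IsPolyFun.sum fun i _ => ((IsPolyFun.const _).mul (IsPolyFun.coord _)).mul (IsPolyFun.coord _)
    obtain ⟨p, hp⟩ := hv.add (((hDp.mul (IsPolyFun.coord (Sum.inr (Fin.natAdd n 0)))).add
      ((IsPolyFun.const 1).mul (IsPolyFun.coord (Sum.inr (Fin.natAdd n 1))))).add
      ((IsPolyFun.const 0).mul (IsPolyFun.coord (Sum.inr (Fin.natAdd n 2)))))
    exact ⟨p, fun x y => hp (Sum.elim x y)⟩
  · refine fun x => ⟨convex_univ, fun y _ y' _ a b _ _ _ => le_of_eq ?_⟩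
    simp only [hQ, ← dotProduct_append_three, dotProduct_add, dotProduct_smul]
  · refine Metric.isCompact_of_isClosed_isBounded ((isClosed_eq (by fun_prop)
      continuous_const).inter (isClosed_dualCone_dualCone _)) ?_
    refine (Metric.isBounded_Icc (fun _ => (-1 : ℝ)) (fun _ => 1)).subset fun y hy => ?_
    have h1 : y (Fin.natAdd n 0) + y (Fin.natAdd n 1) = 1 := hy.1
    have ha : 0 ≤ y (Fin.natAdd n 0) := by
      simpa using hlin 0 1 0 0 (fun z => by simpa using (hM0 z).le) y hy
    have hs : 0 ≤ y (Fin.natAdd n 1) := by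
      simpa using hlin 0 0 1 0 (fun z => by
        simpa using mul_nonneg (hM0 z).le (hD0 z)) y hy
    have ht1 : 0 ≤ y (Fin.natAdd n 0) + y (Fin.natAdd n 1) + y (Fin.natAdd n 2) := by
      simpa using hlin 0 1 1 1 (fun z => by
        simp only [Pi.zero_apply, zero_mul, Finset.sum_const_zero]
        linarith [(abs_le.1 (hfN z)).1]) y hy
    have ht2 : 0 ≤ y (Fin.natAdd n 0) + y (Fin.natAdd n 1) - y (Fin.natAdd n 2) := by
      simpa [sub_eq_add_neg] using hlin 0 1 1 (-1) (fun z => by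
        simp only [Pi.zero_apply, zero_mul, Finset.sum_const_zero]
        linarith [(abs_le.1 (hfN z)).2]) y hy
    have hz : ∀ (z : Fin n → ℝ) i, z i ^ 2 ≤ D z := fun z i =>
      Finset.single_le_sum (f := fun i => z i ^ 2) (fun _ _ => sq_nonneg _) (Finset.mem_univ i)
    have hv1 : ∀ i, 0 ≤ y (Fin.castAdd 3 i) + (y (Fin.natAdd n 0) + y (Fin.natAdd n 1)) := by
      intro i
      simpa [Pi.single_apply] using hlin (Pi.single i 1) 1 1 0 (fun z => by
        have h : 0 ≤ M z * (z i + (1 + D z)) :=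
          mul_nonneg (hM0 z).le (by nlinarith [hz z i, sq_nonneg (z i + 1)])
        simp only [Pi.single_apply, ite_mul, one_mul, zero_mul, Finset.sum_ite_eq',
          Finset.mem_univ, if_true]
        linarith) y hy
    have hv2 : ∀ i, 0 ≤ -y (Fin.castAdd 3 i) + (y (Fin.natAdd n 0) + y (Fin.natAdd n 1)) := by
      intro i
      simpa [Pi.single_apply] using hlin (Pi.single i (-1)) 1 1 0 (fun z => by
        have h : 0 ≤ M z * (-z i + (1 + D z)) :=
          mul_nonneg (hM0 z).le (by nlinarith [hz z i, sq_nonneg (z i - 1)])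
        simp only [Pi.single_apply, ite_mul, one_mul, zero_mul, neg_mul, Finset.sum_ite_eq',
          Finset.mem_univ, if_true]
        linarith) y hy
    have hall : ∀ j, -1 ≤ y j ∧ y j ≤ 1 := by
      refine Fin.addCases (fun i => ⟨by linarith [hv1 i], by linarith [hv2 i]⟩) fun j => ?_
      match j with
      | 0 => exact ⟨by linarith, by linarith⟩
      | 1 => exact ⟨by linarith, by linarith⟩
      | 2 => exact ⟨by linarith, by linarith⟩
    exact ⟨fun j => (hall j).1, fun j => (hall j).2⟩
  · refine Convex.inter ?_ (convex_dualCone_dualCone _)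
    intro y hy y' hy' a b _ _ hab
    change y _ + y _ = 1 at hy
    change y' _ + y' _ = 1 at hy'
    change a * y _ + b * y' _ + (a * y _ + b * y' _) = 1
    linear_combination a * hy + b * hy' + hab
  · refine SignDet.isSemialgebraic (SignDet.inter (SignDet.eq
      ((IsPolyFun.coord _).add (IsPolyFun.coord _)) (IsPolyFun.const 1)) ?_)
    have hDp : IsPolyFun fun w : Fin n ⊕ Unit → ℝ => D fun i => w (Sum.inl i) :=
      IsPolyFun.sum fun i _ => (IsPolyFun.coord _).pow 2
    have hMp : IsPolyFun fun w : Fin n ⊕ Unit → ℝ => M fun i => w (Sum.inl i) :=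
      (IsPolyFun.const C).mul (((IsPolyFun.const 1).add hDp).pow k)
    have h := SignDet.dualCone_dualCone hsa.signDet
      (F := fun w => lift (fun i => w (Sum.inl i)) (w (Sum.inr ())))
      (Fin.addCases (fun i => by
        simp only [hlift, Fin.append_left]
        exact hMp.mul (IsPolyFun.coord _)) fun j => by
        simp only [hlift, Fin.append_right]
        fin_cases j
        · exact hMp
        · exact hMp.mul hDp
        · exact IsPolyFun.coord _)
    convert h using 1
    ext y
    refine forall_congr' fun c => imp_congr_left ⟨fun h w hw => ?_, ?_⟩
    · have hw' : f (w ∘ Sum.inl) = w (Sum.inr ()) := hw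
      rw [← hw']
      exact h _ ⟨w ∘ Sum.inl, rfl⟩
    · rintro h _ ⟨z, rfl⟩
      exact h (Sum.elim z fun _ => f z) rfl
  · intro x
    refine le_antisymm (iSup₂_le fun y hy => EReal.coe_le_coe_iff.2 ?_) ?_
    · exact hPle x y hy.1 (le_antisymm ((hy.2 _ (hκ x)).trans (hQκ x).le) (hQ0 x y hy.1))
    · refine le_iSup₂_of_le ((M x * (1 + D x))⁻¹ • lift x (f x))
        ⟨hκ x, fun y hy => (hQκ x).le.trans (hQ0 x y hy)⟩ (EReal.coe_le_coe_iff.2 (le_of_eq ?_))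
      change f x = M x * (1 + D x) * ((M x * (1 + D x))⁻¹ * lift x (f x) (Fin.natAdd n 2))
      rw [mul_inv_cancel_left₀ (hN0 x).ne']
      simp only [hlift, Fin.append_right]
      rfl
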